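/- Let n ≥ 3 be an integer and a, b real numbers with 0 ≤ a < (n-2)/2 and a ≤ b < a+1; set q = 2n/(n-2+2(b-a)) and K_{a,b} = ((n-2a-2)(n-bq))^{-1/2} ( ((2-bq+2a)/(n ω_n)) · Γ(n/(a+1-b)) / Γ(n/(2(a+1-b)))^2 )^{(a+1-b)/n}. If C > 0 is a constant such that (∫_{ℝ^n} |x|^{-bq} |f(x)|^q dx)^{1/q} ≤ C (∫_{ℝ^n} |x|^{-2a} |∇f(x)|^2 dx)^{1/2} holds for every smooth compactly supported function f : ℝ^n → ℝ, then C ≥ K_{a,b}. -/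

import Mathlib

open Real MeasureTheory Filter Topology

/-- The volume of the unit ball in `ℝ^n`: `ω_n = π^(n/2) / Γ(n/2 + 1)`. -/
noncomputable def ballVol (n : ℕ) : ℝ := Real.pi ^ ((n : ℝ) / 2) / Real.Gamma ((n : ℝ) / 2 + 1)

/-- The sharp Chou–Chu constant `K_{a,b}` of the Caffarelli–Kohn–Nirenberg inequality,
with `q = 2n/(n-2+2(b-a))`. -/
noncomputable def CKNconst (n : ℕ) (a b : ℝ) : ℝ :=
  (((n : ℝ) - 2 * a - 2) * ((n : ℝ) - b * (2 * n / ((n : ℝ) - 2 + 2 * (b - a))))) ^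
      (-(1 : ℝ) / 2) *
    (((2 - b * (2 * n / ((n : ℝ) - 2 + 2 * (b - a))) + 2 * a) / ((n : ℝ) * ballVol n)) *
        (Real.Gamma ((n : ℝ) / (a + 1 - b)) /
          Real.Gamma ((n : ℝ) / (2 * (a + 1 - b))) ^ 2)) ^ ((a + 1 - b) / (n : ℝ))

theorem integrableOn_beta_kernel {α β : ℝ} (hα : 0 < α) (hβ : 0 < β) :
    IntegrableOn (fun y : ℝ => y ^ (α - 1) * (1 - y) ^ (β - 1)) (Set.Ioo 0 1) ∧
      ∫ y in Set.Ioo (0 : ℝ) 1, y ^ (α - 1) * (1 - y) ^ (β - 1) = ProbabilityTheory.beta α β := by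
  have hα' : 0 < (α : ℂ).re := by simpa
  have hβ' : 0 < (β : ℂ).re := by simpa
  have hker : Set.EqOn (fun y : ℝ => ((y : ℂ) ^ ((α : ℂ) - 1) * (1 - (y : ℂ)) ^ ((β : ℂ) - 1)).re)
      (fun y : ℝ => y ^ (α - 1) * (1 - y) ^ (β - 1)) (Set.Ioo 0 1) := by
    intro y hy
    have h1 : (y : ℂ) ^ ((α : ℂ) - 1) * (1 - (y : ℂ)) ^ ((β : ℂ) - 1)
        = ((y ^ (α - 1) * (1 - y) ^ (β - 1) : ℝ) : ℂ) := by
      rw [Complex.ofReal_mul, Complex.ofReal_cpow hy.1.le,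
        Complex.ofReal_cpow (by linarith [hy.2])]
      push_cast
      rfl
    simp only [h1, Complex.ofReal_re]
  have h_int : IntegrableOn
      (fun y : ℝ => (y : ℂ) ^ ((α : ℂ) - 1) * (1 - (y : ℂ)) ^ ((β : ℂ) - 1)) (Set.Ioo 0 1) :=
    (intervalIntegrable_iff_integrableOn_Ioo_of_le zero_le_one).1
      (Complex.betaIntegral_convergent hα' hβ')
  refine ⟨IntegrableOn.congr_fun h_int.re hker measurableSet_Ioo, ?_⟩
  rw [ProbabilityTheory.beta_eq_betaIntegralReal α β hα hβ, Complex.betaIntegral,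
    intervalIntegral.integral_of_le zero_le_one, integral_Ioc_eq_integral_Ioo,
    ← setIntegral_congr_fun measurableSet_Ioo hker]
  exact integral_re h_int

theorem integrableOn_betaPrime_kernel {α β : ℝ} (hα : 0 < α) (hβ : 0 < β) :
    IntegrableOn (fun t : ℝ => t ^ (α - 1) * (1 + t) ^ (-(α + β))) (Set.Ioi 0) ∧
      ∫ t in Set.Ioi (0 : ℝ), t ^ (α - 1) * (1 + t) ^ (-(α + β)) = ProbabilityTheory.beta α β := by
  have hderiv : ∀ t ∈ Set.Ioi (0 : ℝ),
      HasDerivWithinAt (fun t : ℝ => t / (1 + t)) (1 / (1 + t) ^ 2) (Set.Ioi 0) t := by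
    intro t ht
    have ht' : 1 + t ≠ 0 := by have := Set.mem_Ioi.1 ht; positivity
    refine (((hasDerivAt_id t).div ((hasDerivAt_id t).const_add 1) ht').congr_deriv
      ?_).hasDerivWithinAt
    simp
  have hinj : Set.InjOn (fun t : ℝ => t / (1 + t)) (Set.Ioi 0) := by
    intro x hx y hy hxy
    have hx' : 1 + x ≠ 0 := by have := Set.mem_Ioi.1 hx; positivity
    have hy' : 1 + y ≠ 0 := by have := Set.mem_Ioi.1 hy; positivity
    field_simp at hxy
    linarith
  have himage : (fun t : ℝ => t / (1 + t)) '' Set.Ioi 0 = Set.Ioo 0 1 := by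
    ext y
    constructor
    · rintro ⟨t, ht, rfl⟩
      have ht' : 0 < t := ht
      exact ⟨by positivity, (div_lt_one (by positivity)).2 (by linarith)⟩
    · rintro ⟨h0, h1⟩
      have h1' : 0 < 1 - y := by linarith
      refine ⟨y / (1 - y), div_pos h0 h1', ?_⟩
      simp only
      field_simp
      ring
  have hker : Set.EqOn (fun t : ℝ => |1 / (1 + t) ^ 2| •
        ((t / (1 + t)) ^ (α - 1) * (1 - t / (1 + t)) ^ (β - 1)))
      (fun t : ℝ => t ^ (α - 1) * (1 + t) ^ (-(α + β))) (Set.Ioi 0) := by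
    intro t ht
    have ht' : 0 < t := ht
    have h1 : 0 < 1 + t := by positivity
    have h2 : 1 - t / (1 + t) = (1 + t)⁻¹ := by field_simp; ring
    have h3 : |1 / (1 + t) ^ 2| = (1 + t) ^ (-2 : ℝ) := by
      rw [abs_of_pos (by positivity), rpow_neg h1.le, one_div]
      norm_cast
    simp only [h2, h3, smul_eq_mul]
    rw [div_rpow ht'.le h1.le, inv_rpow h1.le, ← rpow_neg h1.le, div_eq_mul_inv,
      ← rpow_neg h1.le]
    calc _ = t ^ (α - 1) * ((1 + t) ^ (-2 : ℝ) * (1 + t) ^ (-(α - 1)) * (1 + t) ^ (-(β - 1))) := by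
          ring
      _ = _ := by
          rw [← rpow_add h1, ← rpow_add h1]
          ring_nf
  obtain ⟨h1, h2⟩ := integrableOn_beta_kernel hα hβ
  rw [← himage] at h1 h2
  rw [integrableOn_image_iff_integrableOn_abs_deriv_smul measurableSet_Ioi hderiv hinj] at h1
  rw [integral_image_eq_integral_abs_deriv_smul measurableSet_Ioi hderiv hinj] at h2
  exact ⟨h1.congr_fun hker measurableSet_Ioi,
    (setIntegral_congr_fun measurableSet_Ioi hker).symm.trans h2⟩

theorem integrableOn_betaPrime_kernel_comp_rpow {s α β : ℝ} (hs : 0 < s) (hα : 0 < α)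
    (hβ : 0 < β) :
    IntegrableOn (fun r : ℝ => r ^ (s * α - 1) * (1 + r ^ s) ^ (-(α + β))) (Set.Ioi 0) ∧
      ∫ r in Set.Ioi (0 : ℝ), r ^ (s * α - 1) * (1 + r ^ s) ^ (-(α + β)) =
        s⁻¹ * ProbabilityTheory.beta α β := by
  obtain ⟨h1, h2⟩ := integrableOn_betaPrime_kernel hα hβ
  have hker : Set.EqOn
      (fun r : ℝ => (s * r ^ (s - 1)) • ((r ^ s) ^ (α - 1) * (1 + r ^ s) ^ (-(α + β))))
      (fun r : ℝ => s * (r ^ (s * α - 1) * (1 + r ^ s) ^ (-(α + β)))) (Set.Ioi 0) := by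
    intro r hr
    have hr' : 0 < r := hr
    have h : r ^ (s * α - 1) = r ^ (s - 1) * (r ^ s) ^ (α - 1) := by
      rw [← rpow_mul hr'.le, ← rpow_add hr']
      ring_nf
    simp only [h, smul_eq_mul]
    ring
  rw [← integrableOn_Ioi_comp_rpow_iff _ hs.ne', abs_of_pos hs] at h1
  rw [← integral_comp_rpow_Ioi_of_pos hs, setIntegral_congr_fun measurableSet_Ioi hker,
    integral_const_mul] at h2
  have h3 := (h1.congr_fun hker measurableSet_Ioi).const_mul s⁻¹
  refine ⟨IntegrableOn.congr_fun h3 (fun r _ => inv_mul_cancel_left₀ hs.ne' _)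
    measurableSet_Ioi, ?_⟩
  rw [← h2, inv_mul_cancel_left₀ hs.ne']

/-- A smooth cutoff function on `(0, ∞)`, equal to `1` on `[2 / k, k]` and supported in
`[1 / k, 2 * k]`. -/
noncomputable def annularCutoff (k r : ℝ) : ℝ :=
  smoothTransition (k * r - 1) * smoothTransition (2 - r / k)

theorem contDiff_annularCutoff (k : ℝ) : ContDiff ℝ (⊤ : ℕ∞) (annularCutoff k) := by
  unfold annularCutoff
  exact (smoothTransition.contDiff.comp (by fun_prop)).mul
    (smoothTransition.contDiff.comp (by fun_prop))

theorem annularCutoff_eq_zero_of_le {k r : ℝ} (h : k * r ≤ 1) : annularCutoff k r = 0 := by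
  rw [annularCutoff, smoothTransition.zero_of_nonpos (by linarith), zero_mul]

theorem annularCutoff_eq_zero_of_ge {k r : ℝ} (hk : 0 < k) (h : 2 * k ≤ r) :
    annularCutoff k r = 0 := by
  have : 2 ≤ r / k := (le_div_iff₀ hk).2 h
  rw [annularCutoff, smoothTransition.zero_of_nonpos (x := 2 - r / k) (by linarith), mul_zero]

theorem annularCutoff_nonneg (k r : ℝ) : 0 ≤ annularCutoff k r :=
  mul_nonneg (smoothTransition.nonneg _) (smoothTransition.nonneg _)

theorem annularCutoff_le_one (k r : ℝ) : annularCutoff k r ≤ 1 :=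
  mul_le_one₀ (smoothTransition.le_one _) (smoothTransition.nonneg _) (smoothTransition.le_one _)

theorem annularCutoff_eq_one {k r : ℝ} (hk : 0 < k) (h : 2 ≤ k * r) (h' : r ≤ k) :
    annularCutoff k r = 1 := by
  have : r / k ≤ 1 := (div_le_one hk).2 h'
  rw [annularCutoff, smoothTransition.one_of_one_le (by linarith),
    smoothTransition.one_of_one_le (by linarith), one_mul]

theorem eventually_annularCutoff_eventuallyEq_one {r : ℝ} (hr : 0 < r) :
    ∀ᶠ k in atTop, annularCutoff k =ᶠ[𝓝 r] 1 := by
  filter_upwards [eventually_gt_atTop (2 * r), eventually_gt_atTop (4 / r),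
    eventually_gt_atTop 0] with k hk hk' hk0
  filter_upwards [Ioo_mem_nhds (half_lt_self hr) (by linarith : r < 2 * r)] with x hx
  refine annularCutoff_eq_one hk0 ?_ (by linarith [hx.2])
  have h4 : 4 < k * r := (div_lt_iff₀ hr).1 hk'
  nlinarith [hx.1]

theorem deriv_smoothTransition_eq_zero_of_nonpos {x : ℝ} (hx : x ≤ 0) :
    deriv smoothTransition x = 0 :=
  IsLocalMin.deriv_eq_zero <| Eventually.of_forall fun y => by
    rw [smoothTransition.zero_of_nonpos hx]
    exact smoothTransition.nonneg y

theorem deriv_smoothTransition_eq_zero_of_one_le {x : ℝ} (hx : 1 ≤ x) :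
    deriv smoothTransition x = 0 :=
  IsLocalMax.deriv_eq_zero <| Eventually.of_forall fun y => by
    rw [smoothTransition.one_of_one_le hx]
    exact smoothTransition.le_one y

theorem exists_abs_deriv_smoothTransition_le :
    ∃ M, 0 ≤ M ∧ ∀ x, |deriv smoothTransition x| ≤ M := by
  have hc : Continuous (deriv smoothTransition) :=
    (smoothTransition.contDiff (n := 1)).continuous_deriv le_rfl
  have hs : HasCompactSupport (deriv smoothTransition) := by
    refine HasCompactSupport.intro (isCompact_Icc (a := (0 : ℝ)) (b := 1)) fun x hx => ?_
    rcases lt_or_ge x 0 with h | h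
    · exact deriv_smoothTransition_eq_zero_of_nonpos h.le
    · exact deriv_smoothTransition_eq_zero_of_one_le (not_lt.1 fun h' => hx ⟨h, h'.le⟩)
  obtain ⟨M, hM⟩ := hc.bounded_above_of_compact_support hs
  exact ⟨M, (norm_nonneg _).trans (hM 0), hM⟩

theorem hasDerivAt_annularCutoff (k r : ℝ) :
    HasDerivAt (annularCutoff k)
      (deriv smoothTransition (k * r - 1) * k * smoothTransition (2 - r / k) +
        smoothTransition (k * r - 1) * (deriv smoothTransition (2 - r / k) * -(1 / k))) r := by
  have hd : ∀ x, HasDerivAt smoothTransition (deriv smoothTransition x) x := fun x =>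
    ((smoothTransition.contDiff (n := 1)).differentiable one_ne_zero x).hasDerivAt
  have h1 : HasDerivAt (fun r : ℝ => k * r - 1) k r := by
    simpa using ((hasDerivAt_id r).const_mul k).sub_const 1
  have h2 : HasDerivAt (fun r : ℝ => 2 - r / k) (-(1 / k)) r := by
    simpa using ((hasDerivAt_id r).div_const k).const_sub 2
  exact ((hd _).comp r h1).mul ((hd _).comp r h2)

theorem exists_abs_deriv_annularCutoff_le :
    ∃ M, 0 ≤ M ∧ ∀ k r : ℝ, 0 < k → 0 < r → |deriv (annularCutoff k) r| ≤ M / r := by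
  obtain ⟨M, hM0, hM⟩ := exists_abs_deriv_smoothTransition_le
  refine ⟨4 * M, by positivity, fun k r hk hr => ?_⟩
  rw [(hasDerivAt_annularCutoff k r).deriv]
  have ht : ∀ x, |smoothTransition x| ≤ 1 := fun x => by
    rw [abs_of_nonneg (smoothTransition.nonneg x)]
    exact smoothTransition.le_one x
  have h1 : |deriv smoothTransition (k * r - 1) * k| ≤ 2 * M / r := by
    rw [abs_mul, abs_of_pos hk, le_div_iff₀ hr]
    rcases le_or_gt (k * r) 2 with h | h
    · nlinarith [hM (k * r - 1), abs_nonneg (deriv smoothTransition (k * r - 1)), mul_pos hk hr]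
    · rw [deriv_smoothTransition_eq_zero_of_one_le (by linarith)]
      simpa using hM0
  have h2 : |deriv smoothTransition (2 - r / k) * -(1 / k)| ≤ 2 * M / r := by
    rw [abs_mul, abs_neg, abs_of_pos (one_div_pos.2 hk), le_div_iff₀ hr, mul_assoc,
      one_div_mul_eq_div]
    have hrk : 0 < r / k := by positivity
    rcases le_or_gt (r / k) 2 with h | h
    · nlinarith [hM (2 - r / k), abs_nonneg (deriv smoothTransition (2 - r / k))]
    · rw [deriv_smoothTransition_eq_zero_of_nonpos (by linarith)]
      simpa using hM0
  calc _ ≤ |deriv smoothTransition (k * r - 1) * k| * |smoothTransition (2 - r / k)| +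
        |smoothTransition (k * r - 1)| * |deriv smoothTransition (2 - r / k) * -(1 / k)| := by
        rw [← abs_mul, ← abs_mul]; exact abs_add_le _ _
    _ ≤ 2 * M / r * 1 + 1 * (2 * M / r) := by gcongr <;> exact ht _
    _ = 4 * M / r := by ring

section Radial

variable {E : Type*} [NormedAddCommGroup E] [InnerProductSpace ℝ E]

theorem contDiff_comp_norm_of_eq_zero {g : ℝ → ℝ} {ε : ℝ} (hε : 0 < ε)
    (hg : ContDiffOn ℝ (⊤ : ℕ∞) g (Set.Ioi 0)) (h0 : ∀ r ≤ ε, g r = 0) :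
    ContDiff ℝ (⊤ : ℕ∞) (fun x : E => g ‖x‖) := by
  refine contDiff_iff_contDiffAt.2 fun x => ?_
  rcases eq_or_ne x 0 with rfl | hx
  · refine (contDiffAt_const (c := (0 : ℝ))).congr_of_eventuallyEq ?_
    filter_upwards [Metric.ball_mem_nhds (0 : E) hε] with y hy
    exact h0 _ (mem_ball_zero_iff.1 hy).le
  · exact (hg.contDiffAt (Ioi_mem_nhds (norm_pos_iff.2 hx))).comp x (contDiffAt_norm ℝ hx)

theorem hasCompactSupport_comp_norm_of_eq_zero [FiniteDimensional ℝ E] {g : ℝ → ℝ} {R : ℝ}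
    (h0 : ∀ r, R ≤ r → g r = 0) : HasCompactSupport (fun x : E => g ‖x‖) := by
  refine HasCompactSupport.intro (isCompact_closedBall (0 : E) R) fun x hx => h0 _ ?_
  rw [mem_closedBall_zero_iff, not_le] at hx
  exact hx.le

theorem norm_fderiv_comp_norm [Nontrivial E] {g : ℝ → ℝ} {ε : ℝ} (hε : 0 < ε)
    (hg : ContDiffOn ℝ (⊤ : ℕ∞) g (Set.Ioi 0)) (h0 : ∀ r ≤ ε, g r = 0) (x : E) :
    ‖fderiv ℝ (fun x : E => g ‖x‖) x‖ = |deriv g ‖x‖| := by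
  rcases eq_or_ne x 0 with rfl | hx
  · have h1 : (fun x : E => g ‖x‖) =ᶠ[𝓝 0] fun _ => 0 := by
      filter_upwards [Metric.ball_mem_nhds (0 : E) hε] with y hy
      exact h0 _ (mem_ball_zero_iff.1 hy).le
    have h2 : g =ᶠ[𝓝 0] fun _ => 0 := by
      filter_upwards [Iio_mem_nhds hε] with y hy
      exact h0 _ (le_of_lt hy)
    rw [h1.fderiv_eq, norm_zero, h2.deriv_eq]
    simp
  · have hd : DifferentiableAt ℝ (‖·‖) x := (contDiffAt_norm ℝ hx (n := 1)).differentiableAt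
      one_ne_zero
    have hg' : DifferentiableAt ℝ g ‖x‖ :=
      (hg.contDiffAt (Ioi_mem_nhds (norm_pos_iff.2 hx))).differentiableAt (by simp)
    have h := hg'.hasDerivAt.comp_hasFDerivAt x hd.hasFDerivAt
    have h' : fderiv ℝ (fun x : E => g ‖x‖) x = deriv g ‖x‖ • fderiv ℝ (‖·‖) x := h.fderiv
    rw [h', norm_smul, norm_fderiv_norm hd, mul_one, Real.norm_eq_abs]

/-- A weighted Sobolev inequality for smooth compactly supported functions extends to radial
functions whose profile is smooth on `(0, ∞)` and satisfies the natural integrability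
conditions. -/
theorem weighted_sobolev_radial [Nontrivial E] [FiniteDimensional ℝ E] [MeasurableSpace E]
    [BorelSpace E] (μ : Measure E) [μ.IsAddHaarMeasure] {A B q C : ℝ} (hq : 0 < q)
    (hineq : ∀ f : E → ℝ, ContDiff ℝ (⊤ : ℕ∞) f → HasCompactSupport f →
      (∫ x, ‖x‖ ^ A * |f x| ^ q ∂μ) ^ (1 / q) ≤
        C * (∫ x, ‖x‖ ^ B * ‖fderiv ℝ f x‖ ^ 2 ∂μ) ^ ((1 : ℝ) / 2))
    {u : ℝ → ℝ} (hu : ContDiffOn ℝ (⊤ : ℕ∞) u (Set.Ioi 0))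
    (h_int : IntegrableOn (fun r => r ^ (Module.finrank ℝ E - 1) • (r ^ A * |u r| ^ q))
      (Set.Ioi 0))
    (h_int' : IntegrableOn (fun r => r ^ (Module.finrank ℝ E - 1) • (r ^ B * (deriv u r) ^ 2))
      (Set.Ioi 0))
    (h_int'' : IntegrableOn (fun r => r ^ (Module.finrank ℝ E - 1) • (r ^ B * (u r / r) ^ 2))
      (Set.Ioi 0)) :
    (Module.finrank ℝ E • μ.real (Metric.ball 0 1) •
        ∫ r in Set.Ioi (0 : ℝ), r ^ (Module.finrank ℝ E - 1) • (r ^ A * |u r| ^ q)) ^ (1 / q) ≤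
      C * (Module.finrank ℝ E • μ.real (Metric.ball 0 1) •
        ∫ r in Set.Ioi (0 : ℝ), r ^ (Module.finrank ℝ E - 1) • (r ^ B * (deriv u r) ^ 2)) ^
          ((1 : ℝ) / 2) := by
  set d := Module.finrank ℝ E
  set v : ℝ → ℝ → ℝ := fun k r => annularCutoff k r * u r with hv
  have hvsmooth : ∀ k, ContDiffOn ℝ (⊤ : ℕ∞) (v k) (Set.Ioi 0) := fun k =>
    (contDiff_annularCutoff k).contDiffOn.mul hu
  have hvderiv : ∀ k r, 0 < r →
      deriv (v k) r = deriv (annularCutoff k) r * u r + annularCutoff k r * deriv u r := by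
    intro k r hr
    exact ((contDiff_annularCutoff k).differentiable (by simp) r).hasDerivAt.mul
      ((hu.contDiffAt (Ioi_mem_nhds hr)).differentiableAt (by simp)).hasDerivAt |>.deriv
  have hveq : ∀ r, 0 < r → ∀ᶠ k in atTop, v k =ᶠ[𝓝 r] u := by
    intro r hr
    filter_upwards [eventually_annularCutoff_eventuallyEq_one hr] with k hk
    filter_upwards [hk] with x hx
    simp [hv, hx]
  have hae : ∀ᵐ r ∂(volume.restrict (Set.Ioi (0 : ℝ))), 0 < r :=
    ae_restrict_mem measurableSet_Ioi
  have hpow : ContinuousOn (fun r : ℝ => r ^ (d - 1)) (Set.Ioi 0) := by fun_prop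
  have hrpow : ∀ c : ℝ, ContinuousOn (fun r : ℝ => r ^ c) (Set.Ioi 0) := fun c r hr =>
    (continuousAt_rpow_const r c (Or.inl (ne_of_gt hr))).continuousWithinAt
  have hlim : Tendsto (fun k => ∫ r in Set.Ioi (0 : ℝ), r ^ (d - 1) • (r ^ A * |v k r| ^ q)) atTop
      (𝓝 (∫ r in Set.Ioi (0 : ℝ), r ^ (d - 1) • (r ^ A * |u r| ^ q))) := by
    refine tendsto_integral_filter_of_dominated_convergence _ (Eventually.of_forall fun k => ?_)
      (Eventually.of_forall fun k => ?_) h_int ?_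
    · refine ContinuousOn.aestronglyMeasurable ?_ measurableSet_Ioi
      exact hpow.smul ((hrpow A).mul
        ((hvsmooth k).continuousOn.abs.rpow_const fun _ _ => Or.inr hq.le))
    · filter_upwards [hae] with r hr
      have h1 : |v k r| ≤ |u r| := by
        rw [hv, abs_mul, abs_of_nonneg (annularCutoff_nonneg k r)]
        exact mul_le_of_le_one_left (abs_nonneg _) (annularCutoff_le_one k r)
      rw [Real.norm_of_nonneg (by rw [smul_eq_mul]; positivity)]
      simp only [smul_eq_mul]
      gcongr
    · filter_upwards [hae] with r hr
      refine tendsto_const_nhds.congr' ?_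
      filter_upwards [hveq r hr] with k hk
      rw [hk.eq_of_nhds]
  have hlim' : Tendsto
      (fun k => ∫ r in Set.Ioi (0 : ℝ), r ^ (d - 1) • (r ^ B * (deriv (v k) r) ^ 2)) atTop
      (𝓝 (∫ r in Set.Ioi (0 : ℝ), r ^ (d - 1) • (r ^ B * (deriv u r) ^ 2))) := by
    obtain ⟨M, -, hM⟩ := exists_abs_deriv_annularCutoff_le
    refine tendsto_integral_filter_of_dominated_convergence
      (fun r => 2 * M ^ 2 * (r ^ (d - 1) • (r ^ B * (u r / r) ^ 2)) +
        2 * (r ^ (d - 1) • (r ^ B * (deriv u r) ^ 2)))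
      (Eventually.of_forall fun k => ?_) ?_ ((h_int''.const_mul _).add (h_int'.const_mul _)) ?_
    · refine Measurable.aestronglyMeasurable ?_
      have := measurable_deriv (v k)
      fun_prop
    · filter_upwards [eventually_gt_atTop 0] with k hk
      filter_upwards [hae] with r hr
      rw [Real.norm_of_nonneg (by rw [smul_eq_mul]; positivity), hvderiv k r hr]
      have h1 : (deriv (annularCutoff k) r * u r) ^ 2 ≤ M ^ 2 * (u r / r) ^ 2 := by
        rw [← mul_pow, ← sq_abs, abs_mul, ← sq_abs (M * _)]
        gcongr
        calc _ ≤ M / r * |u r| := by gcongr; exact hM k r hk hr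
          _ = M * |u r / r| := by rw [abs_div, abs_of_pos hr]; ring
          _ ≤ _ := by rw [abs_mul]; gcongr; exact le_abs_self M
      have h2 : (annularCutoff k r * deriv u r) ^ 2 ≤ (deriv u r) ^ 2 := by
        rw [mul_pow]
        exact mul_le_of_le_one_left (sq_nonneg _)
          (pow_le_one₀ (annularCutoff_nonneg k r) (annularCutoff_le_one k r))
      have h3 : (deriv (annularCutoff k) r * u r + annularCutoff k r * deriv u r) ^ 2 ≤
          2 * (M ^ 2 * (u r / r) ^ 2) + 2 * (deriv u r) ^ 2 := by
        linarith [add_sq_le (a := deriv (annularCutoff k) r * u r)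
          (b := annularCutoff k r * deriv u r)]
      calc _ ≤ r ^ (d - 1) •
            (r ^ B * (2 * (M ^ 2 * (u r / r) ^ 2) + 2 * (deriv u r) ^ 2)) := by
            simp only [smul_eq_mul]; gcongr
        _ = _ := by simp only [smul_eq_mul]; ring
    · filter_upwards [hae] with r hr
      refine tendsto_const_nhds.congr' ?_
      filter_upwards [hveq r hr] with k hk
      rw [hk.deriv_eq]
  refine le_of_tendsto_of_tendsto
    (((hlim.const_smul (μ.real (Metric.ball 0 1))).const_smul d).rpow_const
      (Or.inr (by positivity)))
    ((((hlim'.const_smul (μ.real (Metric.ball 0 1))).const_smul d).rpow_const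
      (Or.inr (by positivity))).const_mul C) ?_
  filter_upwards [eventually_gt_atTop 0] with k hk
  have hk' : 0 < 1 / k := by positivity
  have hv0 : ∀ r ≤ 1 / k, v k r = 0 := fun r hr => by
    simp only [hv]
    rw [annularCutoff_eq_zero_of_le ((le_div_iff₀' hk).1 hr), zero_mul]
  have hv1 : ∀ r, 2 * k ≤ r → v k r = 0 := fun r hr => by
    simp only [hv]
    rw [annularCutoff_eq_zero_of_ge hk hr, zero_mul]
  have h := hineq (fun x => v k ‖x‖) (contDiff_comp_norm_of_eq_zero hk' (hvsmooth k) hv0)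
    (hasCompactSupport_comp_norm_of_eq_zero hv1)
  simp only [norm_fderiv_comp_norm hk' (hvsmooth k) hv0, sq_abs] at h
  rwa [integral_fun_norm_addHaar μ (fun r => r ^ A * |v k r| ^ q),
    integral_fun_norm_addHaar μ (fun r => r ^ B * (deriv (v k) r) ^ 2)] at h

end Radial

theorem volume_real_ball_eq_ballVol {n : ℕ} (hn : 0 < n) :
    volume.real (Metric.ball (0 : EuclideanSpace ℝ (Fin n)) 1) = ballVol n := by
  have : Nonempty (Fin n) := Fin.pos_iff_nonempty.1 hn
  rw [measureReal_def, EuclideanSpace.volume_ball, ENNReal.ofReal_one, one_pow, one_mul,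
    Fintype.card_fin, ENNReal.toReal_ofReal, ballVol, sqrt_eq_rpow,
    ← rpow_natCast, ← rpow_mul pi_nonneg]
  · ring_nf
  · have : 0 < Real.Gamma ((n : ℝ) / 2 + 1) := Gamma_pos_of_pos (by positivity)
    positivity

theorem beta_add_two_self {p : ℝ} (hp : 0 < p) :
    ProbabilityTheory.beta (p + 2) p =
      (p + 1) / p * ProbabilityTheory.beta (p + 1) (p + 1) := by
  have h1 : Real.Gamma (p + 2) = (p + 1) * Real.Gamma (p + 1) := by
    rw [← Gamma_add_one (by positivity)]
    ring_nf
  have h2 : Real.Gamma (p + 1) = p * Real.Gamma p := Gamma_add_one hp.ne'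
  rw [ProbabilityTheory.beta, ProbabilityTheory.beta, h1, h2,
    show p + 2 + p = p + 1 + (p + 1) by ring]
  field_simp

section TalentiBubble

variable {s p : ℝ}

theorem contDiffOn_one_add_rpow_rpow :
    ContDiffOn ℝ (⊤ : ℕ∞) (fun r : ℝ => (1 + r ^ s) ^ (-p)) (Set.Ioi 0) := by
  intro r hr
  have hr' : 0 < r := hr
  have h : 1 + r ^ s ≠ 0 := by positivity
  exact ((contDiffAt_const.add (contDiffAt_id.rpow_const_of_ne hr'.ne')).rpow_const_of_ne
    h).contDiffWithinAt

theorem deriv_one_add_rpow_rpow {r : ℝ} (hr : 0 < r) :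
    deriv (fun r : ℝ => (1 + r ^ s) ^ (-p)) r =
      -(s * p) * (r ^ (s - 1) * (1 + r ^ s) ^ (-p - 1)) := by
  have h : 1 + r ^ s ≠ 0 := by positivity
  rw [(((hasDerivAt_rpow_const (p := s) (Or.inl hr.ne')).const_add 1).rpow_const
    (p := -p) (Or.inl h)).deriv]
  ring

end TalentiBubble

theorem pow_mul_rpow_mul_rpow_eq {d : ℕ} {A c e c' s r : ℝ} (hr : 0 < r)
    (h : (d : ℝ) + A + c = c') : r ^ d * (r ^ A * (r ^ c * (1 + r ^ s) ^ e)) =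
      r ^ c' * (1 + r ^ s) ^ e := by
  rw [← h, rpow_add hr, rpow_add hr, rpow_natCast]
  ring

/-- Sharpness of the Chou–Chu constant in the Caffarelli–Kohn–Nirenberg inequality
in `ℝ^n` (Euclidean case of Theorem 5.1). -/
theorem CKN_sharpness (n : ℕ) (hn : 3 ≤ n) (a b : ℝ) (ha0 : 0 ≤ a)
    (ha : a < ((n : ℝ) - 2) / 2) (hab : a ≤ b) (hb : b < a + 1)
    (q : ℝ) (hq : q = 2 * n / ((n : ℝ) - 2 + 2 * (b - a))) (C : ℝ) (hC : 0 < C)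
    (hineq : ∀ f : EuclideanSpace ℝ (Fin n) → ℝ, ContDiff ℝ (⊤ : ℕ∞) f →
      HasCompactSupport f →
      (∫ x : EuclideanSpace ℝ (Fin n), ‖x‖ ^ (-(b * q)) * |f x| ^ q) ^ (1 / q) ≤
        C * (∫ x : EuclideanSpace ℝ (Fin n), ‖x‖ ^ (-(2 * a)) * ‖fderiv ℝ f x‖ ^ 2) ^
          ((1 : ℝ) / 2)) :
    CKNconst n a b ≤ C := by
  have hn3 : (3 : ℝ) ≤ n := by exact_mod_cast hn
  have hcast : ((n - 1 : ℕ) : ℝ) = n - 1 := by rw [Nat.cast_sub (by omega), Nat.cast_one]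
  have : Nonempty (Fin n) := Fin.pos_iff_nonempty.1 (by omega)
  unfold CKNconst
  rw [← hq]
  obtain ⟨γ, hγ⟩ : ∃ γ, γ = a + 1 - b := ⟨_, rfl⟩
  obtain ⟨m, hm⟩ : ∃ m, m = (n : ℝ) - 2 * a - 2 := ⟨_, rfl⟩
  have hγ0 : 0 < γ := by linarith
  have hm0 : 0 < m := by linarith
  have hD : 0 < (n : ℝ) - 2 * γ := by linarith
  have hn0 : (0 : ℝ) < n := by linarith
  replace hq : q = 2 * n / (n - 2 * γ) := by rw [hq, hγ]; ring_nf
  have hq0 : 0 < q := by rw [hq]; positivity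
  obtain ⟨s, hs⟩ : ∃ s, s = 2 * γ * m / (n - 2 * γ) := ⟨_, rfl⟩
  obtain ⟨p, hp⟩ : ∃ p, p = (n - 2 * γ) / (2 * γ) := ⟨_, rfl⟩
  have hs0 : 0 < s := by rw [hs]; positivity
  have hp0 : 0 < p := by rw [hp]; positivity
  have hsp : s * p = m := by rw [hs, hp]; field_simp
  have hnbq : n - b * q = n * m / (n - 2 * γ) := by
    rw [hq]
    field_simp
    linear_combination -hm - 2 * hγ
  have hnbq' : n - b * q = s * (p + 1) := by
    rw [hnbq, hs, hp]
    field_simp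
    ring
  have hpq : p * q = 2 * (p + 1) := by
    rw [hp, hq]
    field_simp
    ring
  obtain ⟨hi1, he1⟩ := integrableOn_betaPrime_kernel_comp_rpow hs0
    (add_pos hp0 one_pos) (add_pos hp0 one_pos)
  obtain ⟨hi2, he2⟩ := integrableOn_betaPrime_kernel_comp_rpow hs0 (add_pos hp0 two_pos) hp0
  obtain ⟨hi3, -⟩ := integrableOn_betaPrime_kernel_comp_rpow hs0 hp0 hp0
  have hk1 : Set.EqOn
      (fun r : ℝ => r ^ (s * (p + 1) - 1) * (1 + r ^ s) ^ (-(p + 1 + (p + 1))))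
      (fun r => r ^ (n - 1) • (r ^ (-(b * q)) * |(1 + r ^ s) ^ (-p)| ^ q)) (Set.Ioi 0) := by
    intro r hr
    have hr' : 0 < r := hr
    have h1 : |(1 + r ^ s) ^ (-p)| ^ q = r ^ (0 : ℝ) * (1 + r ^ s) ^ (-(p + 1 + (p + 1))) := by
      rw [abs_of_pos (by positivity), ← rpow_mul (by positivity), rpow_zero, one_mul]
      congr 1
      linarith
    simp only [h1, smul_eq_mul]
    refine (pow_mul_rpow_mul_rpow_eq hr' ?_).symm
    linarith
  have hk2 : Set.EqOn
      (fun r : ℝ => m ^ 2 * (r ^ (s * (p + 2) - 1) * (1 + r ^ s) ^ (-(p + 2 + p))))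
      (fun r => r ^ (n - 1) •
        (r ^ (-(2 * a)) * (deriv (fun r : ℝ => (1 + r ^ s) ^ (-p)) r) ^ 2)) (Set.Ioi 0) := by
    intro r hr
    have hr' : 0 < r := hr
    have h1 : (r ^ (s - 1) * (1 + r ^ s) ^ (-p - 1)) ^ 2 =
        r ^ (2 * (s - 1)) * (1 + r ^ s) ^ (-(p + 2 + p)) := by
      rw [mul_pow, ← rpow_mul_natCast hr'.le, ← rpow_mul_natCast (by positivity)]
      push_cast
      ring_nf
    simp only [deriv_one_add_rpow_rpow hr', hsp, mul_pow (-m), h1, neg_sq, smul_eq_mul]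
    rw [← pow_mul_rpow_mul_rpow_eq (d := n - 1) (A := -(2 * a)) (c := 2 * (s - 1)) hr'
      (by rw [hcast]; linarith)]
    ring
  have hk3 : Set.EqOn
      (fun r : ℝ => r ^ (s * p - 1) * (1 + r ^ s) ^ (-(p + p)))
      (fun r => r ^ (n - 1) • (r ^ (-(2 * a)) * ((1 + r ^ s) ^ (-p) / r) ^ 2)) (Set.Ioi 0) := by
    intro r hr
    have hr' : 0 < r := hr
    have h1 : ((1 + r ^ s) ^ (-p) / r) ^ 2 = r ^ (-2 : ℝ) * (1 + r ^ s) ^ (-(p + p)) := by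
      rw [div_pow, ← rpow_mul_natCast (by positivity), rpow_neg hr'.le, div_eq_inv_mul]
      push_cast
      rw [rpow_two]
      ring_nf
    simp only [h1, smul_eq_mul]
    refine (pow_mul_rpow_mul_rpow_eq hr' ?_).symm
    linarith
  have key := weighted_sobolev_radial (volume : Measure (EuclideanSpace ℝ (Fin n))) hq0 hineq
    (contDiffOn_one_add_rpow_rpow (s := s) (p := p))
  simp only [finrank_euclideanSpace_fin] at key
  specialize key (hi1.congr_fun hk1 measurableSet_Ioi)
    (IntegrableOn.congr_fun (hi2.const_mul _) hk2 measurableSet_Ioi)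
    (hi3.congr_fun hk3 measurableSet_Ioi)
  rw [← setIntegral_congr_fun measurableSet_Ioi hk1, ← setIntegral_congr_fun measurableSet_Ioi hk2,
    integral_const_mul, he1, he2, beta_add_two_self hp0,
    volume_real_ball_eq_ballVol (by omega)] at key
  simp only [nsmul_eq_mul, smul_eq_mul] at key
  have hω : 0 < ballVol n :=
    div_pos (by positivity) (Gamma_pos_of_pos (by positivity))
  have hβ := ProbabilityTheory.beta_pos (add_pos hp0 one_pos) (add_pos hp0 one_pos)
  obtain ⟨X, hX⟩ : ∃ X, X = n * (ballVol n * (s⁻¹ * ProbabilityTheory.beta (p + 1) (p + 1))) :=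
    ⟨_, rfl⟩
  have hX0 : 0 < X := by rw [hX]; positivity
  have hY : m * (n - b * q) = m ^ 2 * ((p + 1) / p) := by
    rw [hnbq', ← hsp]
    field_simp
  obtain ⟨Y, hY'⟩ : ∃ Y, Y = m * (n - b * q) := ⟨_, rfl⟩
  have hY0 : 0 < Y := by rw [hY', hY]; positivity
  have hYX : n * (ballVol n *
      (m ^ 2 * (s⁻¹ * ((p + 1) / p * ProbabilityTheory.beta (p + 1) (p + 1))))) = Y * X := by
    rw [hX, hY', hY]
    ring
  rw [← hX, hYX] at key
  have hs' : 2 - b * q + 2 * a = s := by linarith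
  have hN : n / (2 * γ) = p + 1 := by rw [hp]; field_simp; ring
  have hN' : n / γ = p + 1 + (p + 1) := by rw [← hN]; field_simp; ring
  have hXinv : s / (n * ballVol n) *
      (Real.Gamma (p + 1 + (p + 1)) / Real.Gamma (p + 1) ^ 2) = X⁻¹ := by
    have h1 := Gamma_pos_of_pos (add_pos hp0 one_pos)
    have h2 := Gamma_pos_of_pos (add_pos (add_pos hp0 one_pos) (add_pos hp0 one_pos))
    rw [hX, ProbabilityTheory.beta]
    field_simp
  have hexp : 1 / q = 1 / 2 + -(γ / n) := by
    rw [hq]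
    field_simp
    ring
  rw [← hγ, ← hm, hs', hN, hN', hXinv, ← hY', neg_div, rpow_neg hY0.le, inv_rpow hX0.le,
    ← rpow_neg hX0.le]
  rw [hexp, rpow_add hX0, mul_rpow hY0.le hX0.le] at key
  have hXh : 0 < X ^ ((1 : ℝ) / 2) := by positivity
  have hYh : 0 < Y ^ ((1 : ℝ) / 2) := by positivity
  rw [inv_mul_le_iff₀ hYh]
  refine le_of_mul_le_mul_left ?_ hXh
  linarith
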